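/- Let n ≥ p and let A, E ∈ ℝ^{n×p} satisfy AᵀE = 0 and suppose AᵀA + EᵀE is invertible. Regard C'(X) := AᵀA + X·(EᵀE) as a p×p matrix with entries in the polynomial ring ℝ[X], and for i ≥ 0 let c_i denote the coefficient of X^i in det C'(X). Fix 0 ≤ l ≤ p and suppose c_i = 0 for all i ≤ l. Then: (a) the coefficient of X^i in the adjugate matrix adj C'(X) is the zero matrix for all i < l; and (b) the matrix product (coefficient of X^l in adj C'(X)) · (AᵀA) is the zero matrix. -/

import Mathlib

open Matrix Polynomial

namespace Matrix

variable {m n R : Type*} [Fintype n]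

/-- The constant coefficient of a product with a linear matrix pencil. -/
theorem map_coeff_zero_mul_pencil [CommRing R] (M : Matrix m n R[X]) (P Q : Matrix n n R) :
    (M * (P.map Polynomial.C + (Polynomial.X : R[X]) • Q.map Polynomial.C)).map
        (fun q => q.coeff 0) = M.map (fun q => q.coeff 0) * P := by
  ext i j
  simp [mul_apply, finsetSum_coeff, mul_add, mul_coeff_zero]

/-- The higher coefficients of a product with a linear matrix pencil. -/
theorem map_coeff_succ_mul_pencil [CommRing R] (M : Matrix m n R[X]) (P Q : Matrix n n R)
    (k : ℕ) :
    (M * (P.map Polynomial.C + (Polynomial.X : R[X]) • Q.map Polynomial.C)).map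
        (fun q => q.coeff (k + 1)) =
      M.map (fun q => q.coeff (k + 1)) * P + M.map (fun q => q.coeff k) * Q := by
  ext i j
  simp [mul_apply, finsetSum_coeff, mul_add, Finset.sum_add_distrib, ← mul_assoc]

/-- If `B P = 0` and `D P + B EᵀE = 0` with `P` symmetric and `P + EᵀE` invertible,
then `B = 0`. -/
theorem eq_zero_of_mul_eq_zero_of_mul_add_mul_gram_eq_zero {k : Type*} [Fintype m] [Fintype k]
    [DecidableEq n] {P : Matrix n n ℝ} {E : Matrix k n ℝ} (hP : P.IsSymm)
    (hinv : IsUnit (P + Eᵀ * E)) {B D : Matrix m n ℝ} (hB : B * P = 0)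
    (hD : D * P + B * (Eᵀ * E) = 0) : B = 0 := by
  have hPB : P * Bᵀ = 0 := by
    simpa [transpose_mul, hP.eq] using congrArg transpose hB
  have hBE : B * Eᵀ = 0 := by
    rw [← self_mul_conjTranspose_eq_zero, conjTranspose_eq_transpose_of_trivial]
    have h := congrArg (· * Bᵀ) hD
    simpa [Matrix.add_mul, Matrix.mul_assoc, hPB] using h
  have hS : B * (P + Eᵀ * E) = 0 := by
    rw [Matrix.mul_add, hB, ← Matrix.mul_assoc, hBE, Matrix.zero_mul, add_zero]
  rw [← mul_nonsing_inv_cancel_right (A := P + Eᵀ * E) B ((isUnit_iff_isUnit_det _).mp hinv),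
    hS, Matrix.zero_mul]

end Matrix

/-- Let `AᵀE = 0` with `AᵀA + EᵀE` invertible, and let
`C'(X) = AᵀA + X·(EᵀE)` over `ℝ[X]`, with `c_i` the coefficient of `X^i` in `det C'(X)`.
If `c_i = 0` for all `i ≤ l`, then all coefficients of `X^i` in `adj C'(X)` vanish for
`i < l`, and the coefficient of `X^l` in `adj C'(X)` multiplied by `AᵀA` is zero. -/
theorem stmt5 {n p : ℕ} (hnp : p ≤ n)
    (A E : Matrix (Fin n) (Fin p) ℝ)
    (hAE : Aᵀ * E = 0)
    (hinv : IsUnit (Aᵀ * A + Eᵀ * E))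
    (C' : Matrix (Fin p) (Fin p) (Polynomial ℝ))
    (hC' : C' = (Aᵀ * A).map Polynomial.C
        + (Polynomial.X : Polynomial ℝ) • (Eᵀ * E).map Polynomial.C)
    (l : ℕ) (hl : l ≤ p)
    (hc : ∀ i ≤ l, (C'.det).coeff i = 0) :
    (∀ i < l, C'.adjugate.map (fun q => q.coeff i) = 0) ∧
    (C'.adjugate.map (fun q => q.coeff l)) * (Aᵀ * A) = 0 := by
  subst hC'
  set P := Aᵀ * A with hPdef
  set M := P.map Polynomial.C + (Polynomial.X : ℝ[X]) • (Eᵀ * E).map Polynomial.C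
  have hP : P.IsSymm := by simp [hPdef, IsSymm, transpose_mul]
  have hprod : ∀ i ≤ l, (M.adjugate * M).map (fun q => q.coeff i) = 0 := by
    intro i hi
    ext a b
    by_cases hab : a = b <;> simp [adjugate_mul, one_apply, hab, hc i hi]
  have hzero : M.adjugate.map (fun q => q.coeff 0) * P = 0 := by
    rw [← map_coeff_zero_mul_pencil M.adjugate P (Eᵀ * E)]
    exact hprod 0 (Nat.zero_le l)
  have hsucc : ∀ i < l, M.adjugate.map (fun q => q.coeff (i + 1)) * P +
      M.adjugate.map (fun q => q.coeff i) * (Eᵀ * E) = 0 := by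
    intro i hi
    rw [← map_coeff_succ_mul_pencil M.adjugate P (Eᵀ * E)]
    exact hprod (i + 1) hi
  have hmul : ∀ i ≤ l, M.adjugate.map (fun q => q.coeff i) * P = 0 := by
    intro i
    induction i with
    | zero => exact fun _ => hzero
    | succ i ih =>
      intro hi
      have hadj := eq_zero_of_mul_eq_zero_of_mul_add_mul_gram_eq_zero hP hinv
        (ih (Nat.le_of_succ_le hi)) (hsucc i hi)
      simpa [hadj] using hsucc i hi
  exact ⟨fun i hi => eq_zero_of_mul_eq_zero_of_mul_add_mul_gram_eq_zero hP hinv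
    (hmul i hi.le) (hsucc i hi), hmul l le_rfl⟩
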